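/- arXiv:2303.01767 — 3 statements merged into one kernel-verified Lean document; each statement's English description precedes it below -/
import Mathlib

section
/- Suppose Assumption 1 holds, ‖x_i‖₂ ≤ C for all i ∈ [N], λ₀ > 0, and m ≥ (16CN²/λ₀²)·log(2N/δ) for a suitable absolute constant C. If the first-layer weights are initialized i.i.d. w_r ∼ N(0, I_d), then with probability at least 1 − δ the initial Gram matrix satisfies λ_min(H(0)) ≥ (3/4)λ₀. -/
open MeasureTheory ProbabilityTheory Filter

noncomputable section

/-- Dot product on `ℝ^d`. -/
def dot {d : ℕ} (v w : Fin d → ℝ) : ℝ := ∑ k, v k * w k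

/-- Euclidean norm of a vector in `ℝ^d`. -/
def enorm2 {d : ℕ} (v : Fin d → ℝ) : ℝ := Real.sqrt (∑ k, (v k) ^ 2)

/-- Output of the two-layer network `u(W,a,x) = (1/√m) ∑_r a_r σ(w_rᵀ x)`. -/
def netOut {d m : ℕ} (σ : ℝ → ℝ) (W : Fin m → Fin d → ℝ) (a : Fin m → ℝ)
    (x : Fin d → ℝ) : ℝ :=
  (1 / Real.sqrt m) * ∑ r, a r * σ (dot (W r) x)

/-- Quadratic loss `L(W,a) = ∑_i (1/2)|y_i - u(W,a,x_i)|²`. -/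
def quadLoss {d m N : ℕ} (σ : ℝ → ℝ) (x : Fin N → Fin d → ℝ) (y : Fin N → ℝ)
    (W : Fin m → Fin d → ℝ) (a : Fin m → ℝ) : ℝ :=
  ∑ i, (1 / 2) * (y i - netOut σ W a (x i)) ^ 2

/-- Gradient of the quadratic loss with respect to the neuron weight `w_r`:
`∂L/∂w_r = -∑_i (y_i - u_i) (1/√m) a_r σ'(w_rᵀ x_i) x_i`. -/
def gradLoss {d m N : ℕ} (σ : ℝ → ℝ) (x : Fin N → Fin d → ℝ) (y : Fin N → ℝ)
    (W : Fin m → Fin d → ℝ) (a : Fin m → ℝ) (r : Fin m) : Fin d → ℝ :=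
  fun j => -∑ i, (y i - netOut σ W a (x i)) * (1 / Real.sqrt m) * a r
      * deriv σ (dot (W r) (x i)) * x i j

/-- Gradient of the network output `u_i` with respect to the neuron weight `w_r`:
`∂u_i/∂w_r = (1/√m) a_r σ'(w_rᵀ x_i) x_i`. -/
def gradU {d m : ℕ} (σ : ℝ → ℝ) (a : Fin m → ℝ) (xi : Fin d → ℝ)
    (W : Fin m → Fin d → ℝ) (r : Fin m) : Fin d → ℝ :=
  fun j => (1 / Real.sqrt m) * a r * deriv σ (dot (W r) xi) * xi j

/-- Gram matrix `H(W)_{ij} = ∑_r ⟨∂u_i/∂w_r, ∂u_j/∂w_r⟩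
  = (1/m) ∑_r x_iᵀx_j σ'(w_rᵀx_i) σ'(w_rᵀx_j)` (for output weights `a_r ∈ {±1}`). -/
def gram {d m N : ℕ} (σ : ℝ → ℝ) (x : Fin N → Fin d → ℝ)
    (W : Fin m → Fin d → ℝ) : Fin N → Fin N → ℝ :=
  fun i j => (1 / (m : ℝ)) * ∑ r, dot (x i) (x j)
      * deriv σ (dot (W r) (x i)) * deriv σ (dot (W r) (x j))

/-- The standard Gaussian measure `N(0, I_d)` on `ℝ^d`. -/
def stdGaussian (d : ℕ) : Measure (Fin d → ℝ) := Measure.pi fun _ => gaussianReal 0 1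

/-- Limit Gram matrix `H^∞_{ij} = x_iᵀx_j E_{w∼N(0,I)}[σ'(wᵀx_i) σ'(wᵀx_j)]`. -/
def gramInf {d N : ℕ} (σ : ℝ → ℝ) (x : Fin N → Fin d → ℝ) : Fin N → Fin N → ℝ :=
  fun i j => dot (x i) (x j) *
    ∫ w, deriv σ (dot w (x i)) * deriv σ (dot w (x j)) ∂(stdGaussian d)

/-- Smallest eigenvalue of a symmetric matrix, as the minimum of the Rayleigh
quotient over the unit sphere. -/
def lambdaMin {N : ℕ} (H : Fin N → Fin N → ℝ) : ℝ :=
  ⨅ v : {v : Fin N → ℝ // ∑ i, (v i) ^ 2 = 1}, ∑ i, ∑ j, v.1 i * H i j * v.1 j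

/-- Spectral (operator) norm of a matrix, as the supremum of `‖Hv‖₂` over the
unit sphere. -/
def specNorm {N : ℕ} (H : Fin N → Fin N → ℝ) : ℝ :=
  ⨆ v : {v : Fin N → ℝ // ∑ i, (v i) ^ 2 = 1}, enorm2 (fun i => ∑ j, H i j * v.1 j)

/-- Assumption 1: σ is smooth, analytic, not a polynomial, `|σ(0)| ≤ C`, and
both σ and σ' are `c`-Lipschitz. -/
def Assumption1 (σ : ℝ → ℝ) (c C : ℝ) : Prop :=
  ContDiff ℝ (⊤ : ℕ∞) σ ∧ AnalyticOn ℝ σ Set.univ ∧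
    (¬∃ p : Polynomial ℝ, ∀ z, σ z = Polynomial.eval z p) ∧
    |σ 0| ≤ C ∧ (∀ z₁ z₂, |σ z₁ - σ z₂| ≤ c * |z₁ - z₂|) ∧
    (∀ z₁ z₂, |deriv σ z₁ - deriv σ z₂| ≤ c * |z₁ - z₂|)

/-- Assumption 2: no two input data are parallel. -/
def Assumption2 {d N : ℕ} (x : Fin N → Fin d → ℝ) : Prop :=
  ∀ i j : Fin N, i ≠ j → ∀ c : ℝ, x i ≠ c • x j

/-- The implicit gradient descent (IGD) recursion on the first layer:
`W(n+1) = W(n) - α ∂L(W(n+1),a)/∂W(n+1)`. -/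
def IGD {d m N : ℕ} (σ : ℝ → ℝ) (x : Fin N → Fin d → ℝ) (y : Fin N → ℝ)
    (a : Fin m → ℝ) (α : ℝ) (W : ℕ → Fin m → Fin d → ℝ) : Prop :=
  ∀ n r, W (n + 1) r = W n r - α • gradLoss σ x y (W (n + 1)) a r

/-- The Taylor remainder vector `I₀(s)`, where the weights are `W = W(s)`:
`I₀ⁱ = ∑_r ∫₀^α ⟨∂u_i/∂w_r(W + η ∂L/∂W) - ∂u_i/∂w_r(W), ∂L/∂w_r⟩ dη`. -/
def I0 {d m N : ℕ} (σ : ℝ → ℝ) (x : Fin N → Fin d → ℝ) (y : Fin N → ℝ)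
    (a : Fin m → ℝ) (α : ℝ) (W : Fin m → Fin d → ℝ) : Fin N → ℝ :=
  fun i => ∑ r, ∫ η in (0:ℝ)..α,
    dot (gradU σ a (x i) (fun r' => W r' + η • gradLoss σ x y W a r') r
          - gradU σ a (x i) W r)
        (gradLoss σ x y W a r)

end

/-- Hoeffding's inequality (upper tail) for the empirical mean of a bounded function of i.i.d.
samples. -/
lemma measureReal_pi_le_mean_sub_integral_le {E : Type*} [MeasurableSpace E] (μ : Measure E)
    [IsProbabilityMeasure μ] {f : E → ℝ} (hf : Measurable f) {B : ℝ} (hB : 0 < B)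
    (hfB : ∀ w, |f w| ≤ B) {m : ℕ} (hm : 0 < m) {t : ℝ} (ht : 0 ≤ t) :
    (Measure.pi fun _ : Fin m => μ).real {W | t ≤ (1 / (m : ℝ)) * ∑ r, f (W r) - ∫ w, f w ∂μ}
      ≤ Real.exp (-(m * t ^ 2 / (2 * B ^ 2))) := by
  have hm' : (0 : ℝ) < m := by exact_mod_cast hm
  have hsub : HasSubgaussianMGF (fun w => f w - ∫ w, f w ∂μ) ((‖B - -B‖₊ / 2) ^ 2) μ :=
    hasSubgaussianMGF_of_mem_Icc hf.aemeasurable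
      (ae_of_all _ fun w => ⟨(abs_le.1 (hfB w)).1, (abs_le.1 (hfB w)).2⟩)
  have hind : iIndepFun (fun (r : Fin m) (W : Fin m → E) => f (W r) - ∫ w, f w ∂μ)
      (Measure.pi fun _ : Fin m => μ) :=
    iIndepFun_pi (μ := fun _ : Fin m => μ) (X := fun _ w => f w - ∫ w, f w ∂μ)
      fun _ => (hf.sub_const _).aemeasurable
  have hsub' : ∀ r ∈ (Finset.univ : Finset (Fin m)),
      HasSubgaussianMGF (fun W : Fin m → E => f (W r) - ∫ w, f w ∂μ) ((‖B - -B‖₊ / 2) ^ 2)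
        (Measure.pi fun _ : Fin m => μ) := fun r _ => by
    refine HasSubgaussianMGF.of_map (X := fun w => f w - ∫ w, f w ∂μ)
      (Y := fun W : Fin m → E => W r) (measurable_pi_apply r).aemeasurable ?_
    rwa [(measurePreserving_eval (fun _ : Fin m => μ) r).map_eq]
  have h := HasSubgaussianMGF.measure_sum_ge_le_of_iIndepFun hind hsub' (ε := m * t)
    (by positivity)
  have hset : {W : Fin m → E | t ≤ (1 / (m : ℝ)) * ∑ r, f (W r) - ∫ w, f w ∂μ}
      = {W | m * t ≤ ∑ r, (f (W r) - ∫ w, f w ∂μ)} := by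
    ext W
    simp only [Set.mem_ofPred_eq, Finset.sum_sub_distrib, Finset.sum_const, Finset.card_univ,
      Fintype.card_fin, nsmul_eq_mul]
    rw [← mul_le_mul_iff_right₀ hm', mul_sub, ← mul_assoc, mul_one_div_cancel hm'.ne', one_mul]
  rw [hset]
  refine h.trans_eq ?_
  have hnorm : ‖B - -B‖ = 2 * B := by
    rw [Real.norm_eq_abs, abs_of_pos (by linarith)]; ring
  simp only [Finset.sum_const, Finset.card_univ, Fintype.card_fin, nsmul_eq_mul, NNReal.coe_mul,
    NNReal.coe_natCast, NNReal.coe_pow, NNReal.coe_div, coe_nnnorm, NNReal.coe_ofNat, hnorm]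
  congr 1
  field_simp

/-- Two-sided Hoeffding inequality for the empirical mean of a bounded function of i.i.d.
samples. -/
lemma measureReal_pi_le_abs_mean_sub_integral_le {E : Type*} [MeasurableSpace E] (μ : Measure E)
    [IsProbabilityMeasure μ] {f : E → ℝ} (hf : Measurable f) {B : ℝ} (hB : 0 < B)
    (hfB : ∀ w, |f w| ≤ B) {m : ℕ} (hm : 0 < m) {t : ℝ} (ht : 0 ≤ t) :
    (Measure.pi fun _ : Fin m => μ).real {W | t ≤ |(1 / (m : ℝ)) * ∑ r, f (W r) - ∫ w, f w ∂μ|}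
      ≤ 2 * Real.exp (-(m * t ^ 2 / (2 * B ^ 2))) := by
  have hup := measureReal_pi_le_mean_sub_integral_le μ hf hB hfB hm ht
  have hlow := measureReal_pi_le_mean_sub_integral_le μ hf.neg hB
    (fun w => by simpa using hfB w) hm ht
  rw [two_mul]
  refine le_trans ?_ (add_le_add hup hlow)
  refine (measureReal_mono ?_).trans (measureReal_union_le _ _)
  intro W hW
  refine (le_abs.1 (Set.mem_ofPred_eq ▸ hW)).imp id fun h => ?_
  simp only [Set.mem_ofPred_eq, Pi.neg_apply, Finset.sum_neg_distrib, integral_neg]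
  linarith

/-- An entrywise perturbation of size `t` moves the smallest eigenvalue down by at most `N t`. -/
lemma lambdaMin_sub_le_of_forall_abs_sub_le {N : ℕ} (hN : 0 < N) {G H : Fin N → Fin N → ℝ}
    (hG : 0 < lambdaMin G) {t : ℝ} (hGH : ∀ i j, |H i j - G i j| ≤ t) :
    lambdaMin G - N * t ≤ lambdaMin H := by
  have hbdd : BddBelow (Set.range fun v : {v : Fin N → ℝ // ∑ i, (v i) ^ 2 = 1} =>
      ∑ i, ∑ j, v.1 i * G i j * v.1 j) := by
    by_contra hcon
    exact hG.ne' (Real.iInf_of_not_bddBelow hcon)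
  have hne : Nonempty {v : Fin N → ℝ // ∑ i, (v i) ^ 2 = 1} :=
    ⟨⟨Pi.single ⟨0, hN⟩ 1, by simp [Pi.single_apply]⟩⟩
  have ht : 0 ≤ t := (abs_nonneg _).trans (hGH ⟨0, hN⟩ ⟨0, hN⟩)
  refine le_ciInf fun v => ?_
  have hv : lambdaMin G ≤ ∑ i, ∑ j, v.1 i * G i j * v.1 j := ciInf_le hbdd v
  have hcs : (∑ i, |v.1 i|) ^ 2 ≤ N := by
    have := sq_sum_le_card_mul_sum_sq (s := Finset.univ) (f := fun i => |v.1 i|)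
    simpa [v.2] using this
  have hterm : ∀ i j, v.1 i * G i j * v.1 j - |v.1 i| * t * |v.1 j| ≤ v.1 i * H i j * v.1 j := by
    intro i j
    have h : |v.1 i * (H i j - G i j) * v.1 j| ≤ |v.1 i| * t * |v.1 j| := by
      rw [abs_mul, abs_mul]
      gcongr
      exact hGH i j
    linarith [(abs_le.1 h).1]
  have hsum : ∑ i, ∑ j, v.1 i * G i j * v.1 j - (∑ i, |v.1 i|) ^ 2 * t
      ≤ ∑ i, ∑ j, v.1 i * H i j * v.1 j := by
    have h := Finset.sum_le_sum fun i (_ : i ∈ Finset.univ) =>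
      Finset.sum_le_sum fun j (_ : j ∈ Finset.univ) => hterm i j
    simp only [Finset.sum_sub_distrib] at h
    refine le_of_eq_of_le (congrArg _ ?_) h
    rw [sq, Finset.sum_mul_sum, Finset.sum_mul]
    refine Finset.sum_congr rfl fun i _ => ?_
    rw [Finset.sum_mul]
    exact Finset.sum_congr rfl fun j _ => by ring
  linarith [mul_le_mul_of_nonneg_right hcs ht]

lemma abs_dot_le_enorm2_mul_enorm2 {d : ℕ} (v w : Fin d → ℝ) :
    |dot v w| ≤ enorm2 v * enorm2 w := by
  rw [dot, enorm2, enorm2, ← Real.sqrt_mul (Finset.sum_nonneg fun _ _ => sq_nonneg _)]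
  exact Real.abs_le_sqrt (Finset.sum_mul_sq_le_sq_mul_sq _ _ _)

lemma abs_deriv_le_of_forall_abs_sub_le {σ : ℝ → ℝ} {c : ℝ} (hc : 0 ≤ c)
    (hσ : ∀ z₁ z₂, |σ z₁ - σ z₂| ≤ c * |z₁ - z₂|) (z : ℝ) : |deriv σ z| ≤ c := by
  have h : LipschitzWith ⟨c, hc⟩ σ := LipschitzWith.of_dist_le_mul fun z₁ z₂ => hσ z₁ z₂
  exact norm_deriv_le_of_lipschitz h

instance isProbabilityMeasure_stdGaussian (d : ℕ) : IsProbabilityMeasure (stdGaussian d) := by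
  unfold _root_.stdGaussian; infer_instance

/-- Concentration of a single entry of the Gram matrix at initialization. -/
lemma measureReal_le_abs_gram_sub_gramInf_le {d N m : ℕ} {σ : ℝ → ℝ} {c C : ℝ} (hc : 0 < c)
    (hC : 0 < C) (hσ : Assumption1 σ c C) {x : Fin N → Fin d → ℝ} (hx : ∀ i, enorm2 (x i) ≤ C)
    (hm : 0 < m) {t : ℝ} (ht : 0 ≤ t) (i j : Fin N) :
    (Measure.pi fun _ : Fin m => stdGaussian d).real {W | t ≤ |gram σ x W i j - gramInf σ x i j|}
      ≤ 2 * Real.exp (-(m * t ^ 2 / (2 * (C ^ 2 * c ^ 2) ^ 2))) := by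
  obtain ⟨hsmooth, -, -, -, hlip, -⟩ := hσ
  have hder : Continuous (deriv σ) := hsmooth.continuous_deriv (by norm_num)
  have hbd := abs_deriv_le_of_forall_abs_sub_le hc.le hlip
  have hf : Measurable fun w : Fin d → ℝ =>
      dot (x i) (x j) * deriv σ (dot w (x i)) * deriv σ (dot w (x j)) := by
    refine Continuous.measurable ?_
    unfold dot
    fun_prop
  have hfB : ∀ w : Fin d → ℝ,
      |dot (x i) (x j) * deriv σ (dot w (x i)) * deriv σ (dot w (x j))| ≤ C ^ 2 * c ^ 2 := by
    intro w
    have hdot : |dot (x i) (x j)| ≤ C ^ 2 := by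
      rw [sq]
      exact (abs_dot_le_enorm2_mul_enorm2 _ _).trans
        (mul_le_mul (hx i) (hx j) (Real.sqrt_nonneg _) hC.le)
    rw [abs_mul, abs_mul, sq c, ← mul_assoc]
    gcongr <;> exact hbd _
  have h := measureReal_pi_le_abs_mean_sub_integral_le (stdGaussian d) hf (by positivity) hfB hm ht
  simpa only [gram, gramInf, mul_assoc, integral_const_mul] using h

/-- Lemma 2: if `m ≥ (16CN²/λ₀²)·log(2N/δ)` for a suitable constant,
then with probability at least `1 - δ` over the i.i.d. initialization
`w_r ∼ N(0, I_d)`, the initial Gram matrix satisfies `λ_min(H(0)) ≥ (3/4)λ₀`. -/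
theorem init_gram_lambda_min_bound (c C : ℝ) (hc : 0 < c) (hC : 0 < C) :
    ∃ C₀ > 0, ∀ (d N m : ℕ), 0 < N →
      ∀ (σ : ℝ → ℝ), Assumption1 σ c C →
      ∀ (x : Fin N → Fin d → ℝ), (∀ i, enorm2 (x i) ≤ C) →
      ∀ (lam0 : ℝ), lam0 = lambdaMin (gramInf σ x) → 0 < lam0 →
      ∀ (δ : ℝ), 0 < δ → δ < 1 →
      (m : ℝ) ≥ 16 * C₀ * (N : ℝ) ^ 2 / lam0 ^ 2 * Real.log (2 * N / δ) →
      (Measure.pi fun _ : Fin m => stdGaussian d)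
          {W | lambdaMin (gram σ x W) ≥ 3 / 4 * lam0}
        ≥ ENNReal.ofReal (1 - δ) := by
  refine ⟨4 * (C ^ 2 * c ^ 2) ^ 2, by positivity, ?_⟩
  intro d N m hN σ hσ x hx lam0 hlam hpos δ hδ hδ1 hmge
  have hN' : (1 : ℝ) ≤ N := by exact_mod_cast hN
  have hlog : 0 < Real.log (2 * N / δ) := Real.log_pos (by rw [lt_div_iff₀ hδ]; linarith)
  have hm : 0 < m := by
    have : (0 : ℝ) < m := lt_of_lt_of_le (by positivity) hmge
    exact_mod_cast this
  set t : ℝ := lam0 / (4 * N) with ht_def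
  have ht : 0 ≤ t := by positivity
  set P : Measure (Fin m → Fin d → ℝ) := Measure.pi fun _ : Fin m => stdGaussian d
  have hexp : Real.exp (-(m * t ^ 2 / (2 * (C ^ 2 * c ^ 2) ^ 2))) ≤ (δ / (2 * N)) ^ 2 := by
    have hle : 2 * Real.log (2 * N / δ) ≤ m * t ^ 2 / (2 * (C ^ 2 * c ^ 2) ^ 2) := by
      calc 2 * Real.log (2 * N / δ)
          = (16 * (4 * (C ^ 2 * c ^ 2) ^ 2) * (N : ℝ) ^ 2 / lam0 ^ 2 * Real.log (2 * N / δ))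
              * t ^ 2 / (2 * (C ^ 2 * c ^ 2) ^ 2) := by
            rw [ht_def]; field_simp; norm_num
        _ ≤ _ := by gcongr
    calc Real.exp (-(m * t ^ 2 / (2 * (C ^ 2 * c ^ 2) ^ 2)))
        ≤ Real.exp (-(2 * Real.log (2 * N / δ))) := Real.exp_le_exp.2 (neg_le_neg hle)
      _ = (δ / (2 * N)) ^ 2 := by
          rw [← mul_neg, ← Real.log_inv, inv_div, two_mul, Real.exp_add,
            Real.exp_log (by positivity), sq]
  set S : Set (Fin m → Fin d → ℝ) := {W | lambdaMin (gram σ x W) ≥ 3 / 4 * lam0}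
  have hsub : Sᶜ ⊆ ⋃ p : Fin N × Fin N,
      {W | t ≤ |gram σ x W p.1 p.2 - gramInf σ x p.1 p.2|} := by
    intro W hW
    by_contra hcon
    simp only [Set.mem_iUnion, Set.mem_ofPred_eq, not_exists, not_le] at hcon
    refine hW ?_
    have h := lambdaMin_sub_le_of_forall_abs_sub_le hN (hlam ▸ hpos)
      fun i j => (hcon (i, j)).le
    have hNt : N * t = lam0 / 4 := by rw [ht_def]; field_simp
    rw [← hlam, hNt] at h
    change 3 / 4 * lam0 ≤ _
    linarith
  have hbad : P.real Sᶜ ≤ δ :=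
    calc P.real Sᶜ ≤ ∑ p : Fin N × Fin N,
          P.real {W | t ≤ |gram σ x W p.1 p.2 - gramInf σ x p.1 p.2|} :=
          (measureReal_mono hsub).trans (measureReal_iUnion_fintype_le _)
      _ ≤ ∑ _p : Fin N × Fin N, 2 * (δ / (2 * N)) ^ 2 :=
          Finset.sum_le_sum fun p _ =>
            (measureReal_le_abs_gram_sub_gramInf_le hc hC hσ hx hm ht p.1 p.2).trans (by gcongr)
      _ = δ ^ 2 / 2 := by
          simp only [Finset.sum_const, Finset.card_univ, Fintype.card_prod, Fintype.card_fin,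
            nsmul_eq_mul, Nat.cast_mul]
          field_simp
      _ ≤ δ := by nlinarith
  have hgood : 1 - δ ≤ P.real S := by
    have h := measureReal_union_le (μ := P) S Sᶜ
    rw [Set.union_compl_self, probReal_univ] at h
    linarith
  exact (ENNReal.ofReal_le_ofReal hgood).trans_eq (ofReal_measureReal)
end

section
/- Let L: ℝ^N → ℝ be twice continuously differentiable, let α > 0, and suppose θ_n, θ_{n+1} ∈ ℝ^N satisfy the implicit gradient descent relation θ_n = θ_{n+1} + α ∇L(θ_{n+1}). If the Hessian ∇²L(ξ) is positive semidefinite at every point ξ on the segment between θ_n and θ_{n+1}, and ∇L(θ_{n+1}) ≠ 0, then L(θ_{n+1}) < L(θ_n); that is, the IGD step strictly decreases the loss regardless of the magnitude of the Hessian eigenvalues (stiffness). -/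
/-- First-order lower bound for a `C²` function whose second derivative is nonnegative in the
direction `v` along the segment from `x` to `x + v`. -/
theorem add_fderiv_le_of_iteratedFDeriv_two_nonneg {E : Type*} [NormedAddCommGroup E]
    [NormedSpace ℝ E] {f : E → ℝ} (hf : ContDiff ℝ 2 f) (x v : E)
    (hv : ∀ s ∈ Set.Icc (0 : ℝ) 1, 0 ≤ iteratedFDeriv ℝ 2 f (x + s • v) ![v, v]) :
    f x + fderiv ℝ f x v ≤ f (x + v) := by
  have hline (s : ℝ) : HasDerivAt (fun s : ℝ => x + s • v) v s := by
    simpa using ((hasDerivAt_id s).smul_const v).const_add x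
  have hfirst (s : ℝ) :
      HasDerivAt (fun s : ℝ => f (x + s • v)) (fderiv ℝ f (x + s • v) v) s :=
    ((hf.differentiable (by norm_num)) _).hasFDerivAt.comp_hasDerivAt s (hline s)
  have hsecond (s : ℝ) : HasDerivAt (fun s : ℝ => fderiv ℝ f (x + s • v) v)
      (fderiv ℝ (fderiv ℝ f) (x + s • v) v v) s := by
    have hdiff : Differentiable ℝ (fderiv ℝ f) :=
      (hf.fderiv_right (m := 1) (by norm_num)).differentiable (by norm_num)
    have h := (hdiff (x + s • v)).hasFDerivAt.comp_hasDerivAt s (hline s)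
    simpa using h.clm_apply (hasDerivAt_const s v)
  have hmono : MonotoneOn (fun s : ℝ => fderiv ℝ f (x + s • v) v) (Set.Icc 0 1) := by
    refine monotoneOn_of_deriv_nonneg (convex_Icc 0 1)
      (fun s _ => (hsecond s).continuousAt.continuousWithinAt)
      (fun s _ => (hsecond s).differentiableAt.differentiableWithinAt) fun s hs => ?_
    rw [(hsecond s).deriv]
    simpa [iteratedFDeriv_two_apply] using hv s (interior_subset hs)
  obtain ⟨c, hc, hslope⟩ := exists_hasDerivAt_eq_slope (fun s : ℝ => f (x + s • v)) _
    zero_lt_one (fun s _ => (hfirst s).continuousAt.continuousWithinAt) fun s _ => hfirst s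
  have hle := hmono (Set.left_mem_Icc.2 zero_le_one) (Set.Ioo_subset_Icc_self hc) hc.1.le
  simp only [zero_smul, add_zero, one_smul, sub_zero, div_one] at hslope hle
  linarith

/-- if the Hessian is positive semidefinite along the segment
between `θ_n` and `θ_{n+1}` and the gradient at `θ_{n+1}` is nonzero, then an
implicit gradient descent step strictly decreases the loss, regardless of the
magnitude of the Hessian eigenvalues (stiffness). -/
theorem igd_strictly_decreases_loss (N : ℕ)
    (L : EuclideanSpace ℝ (Fin N) → ℝ) (hL : ContDiff ℝ 2 L)
    (α : ℝ) (hα : 0 < α)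
    (θn θn1 : EuclideanSpace ℝ (Fin N))
    (hrel : θn = θn1 + α • gradient L θn1)
    (hpsd : ∀ t ∈ Set.Icc (0 : ℝ) 1, ∀ v : EuclideanSpace ℝ (Fin N),
      0 ≤ iteratedFDeriv ℝ 2 L (t • θn1 + (1 - t) • θn) ![v, v])
    (hgrad : gradient L θn1 ≠ 0) :
    L θn1 < L θn := by
  have hlower := add_fderiv_le_of_iteratedFDeriv_two_nonneg hL θn1 (α • gradient L θn1) <| by
    intro s hs
    have h := hpsd (1 - s) ⟨by linarith [hs.2], by linarith [hs.1]⟩ (α • gradient L θn1)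
    have hpoint : (1 - s) • θn1 + (1 - (1 - s)) • θn = θn1 + s • α • gradient L θn1 := by
      rw [hrel]
      module
    rwa [hpoint] at h
  have hslope : 0 < fderiv ℝ L θn1 (α • gradient L θn1) := by
    rw [← inner_gradient_left, real_inner_smul_right]
    exact mul_pos hα (real_inner_self_pos.2 hgrad)
  rw [← hrel] at hlower
  linarith
end

section
/- Under the IGD update, the residual vectors satisfy the exact recursion y − u(k+1) = (I + α H(k+1))^{−1} [ y − u(k) + I₀(k+1) ] for every step k, where I is the N×N identity matrix. -/
open MeasureTheory ProbabilityTheory Filter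

lemma dot_add_smul_left {d : ℕ} (w g v : Fin d → ℝ) (η : ℝ) :
    dot (w + η • g) v = dot w v + η * dot g v := by
  simp only [dot, Pi.add_apply, Pi.smul_apply, smul_eq_mul, Finset.mul_sum,
    ← Finset.sum_add_distrib]
  exact Finset.sum_congr rfl fun _ _ => by ring

lemma dot_sub_left {d : ℕ} (v w g : Fin d → ℝ) : dot (v - w) g = dot v g - dot w g := by
  simp only [dot, Pi.sub_apply, sub_mul, Finset.sum_sub_distrib]

lemma dot_gradU {d m : ℕ} (σ : ℝ → ℝ) (a : Fin m → ℝ) (v : Fin d → ℝ)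
    (W : Fin m → Fin d → ℝ) (r : Fin m) (g : Fin d → ℝ) :
    dot (gradU σ a v W r) g = (1 / √(m : ℝ)) * a r * (deriv σ (dot (W r) v) * dot g v) := by
  simp only [dot, gradU, Finset.mul_sum]
  exact Finset.sum_congr rfl fun _ _ => by ring

/-- The Gram matrix is the matrix of inner products of the output gradients. -/
lemma gram_eq_sum_dot_gradU {d m N : ℕ} (σ : ℝ → ℝ) (x : Fin N → Fin d → ℝ)
    (a : Fin m → ℝ) (ha : ∀ r, a r = 1 ∨ a r = -1) (W : Fin m → Fin d → ℝ) (i j : Fin N) :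
    gram σ x W i j = ∑ r, dot (gradU σ a (x i) W r) (gradU σ a (x j) W r) := by
  have hm : (1 / √(m : ℝ)) * (1 / √(m : ℝ)) = 1 / (m : ℝ) := by
    rw [div_mul_div_comm, Real.mul_self_sqrt (Nat.cast_nonneg m), one_mul]
  simp only [gram, Finset.mul_sum]
  refine Finset.sum_congr rfl fun r _ => ?_
  have har : a r * a r = 1 := by rcases ha r with h | h <;> simp [h]
  have hx : dot (x j) (x i) = dot (x i) (x j) := by simp only [dot, mul_comm]
  rw [dot_gradU, ← hx, ← hm]
  have hg : dot (gradU σ a (x j) W r) (x i)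
      = (1 / √(m : ℝ)) * a r * (deriv σ (dot (W r) (x j)) * dot (x j) (x i)) := by
    rw [dot_gradU, hx]
  rw [hg]
  linear_combination (-(1 / √(m : ℝ)) * (1 / √(m : ℝ)) * deriv σ (dot (W r) (x i)) *
    deriv σ (dot (W r) (x j)) * dot (x j) (x i)) * har

lemma gram_posSemidef {d m N : ℕ} (σ : ℝ → ℝ) (x : Fin N → Fin d → ℝ)
    (W : Fin m → Fin d → ℝ) : (Matrix.of (gram σ x W)).PosSemidef := by
  let J : Matrix (Fin m × Fin d) (Fin N) ℝ :=
    Matrix.of fun p i => gradU σ (fun _ => 1) (x i) W p.1 p.2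
  have hJ : Matrix.of (gram σ x W) = J.conjTranspose * J := by
    ext i j
    rw [Matrix.of_apply, gram_eq_sum_dot_gradU σ x (fun _ => 1) (fun _ => Or.inl rfl)]
    simp [Matrix.mul_apply, Fintype.sum_prod_type, J, dot]
  rw [hJ]
  exact Matrix.posSemidef_conjTranspose_mul_self J

/-- Moving against the loss gradient changes the outputs, to first order, by the Gram matrix
applied to the residual. -/
lemma sum_dot_gradU_gradLoss {d m N : ℕ} (σ : ℝ → ℝ) (x : Fin N → Fin d → ℝ) (y : Fin N → ℝ)
    (a : Fin m → ℝ) (ha : ∀ r, a r = 1 ∨ a r = -1) (W : Fin m → Fin d → ℝ) (i : Fin N) :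
    ∑ r, dot (gradU σ a (x i) W r) (gradLoss σ x y W a r)
      = -∑ j, gram σ x W i j * (y j - netOut σ W a (x j)) := by
  simp only [gram_eq_sum_dot_gradU σ x a ha, Finset.sum_mul]
  rw [Finset.sum_comm, ← Finset.sum_neg_distrib]
  refine Finset.sum_congr rfl fun r _ => ?_
  simp only [dot, Finset.sum_mul]
  rw [Finset.sum_comm, ← Finset.sum_neg_distrib]
  refine Finset.sum_congr rfl fun l _ => ?_
  simp only [gradLoss, mul_neg, Finset.mul_sum]
  refine congrArg Neg.neg (Finset.sum_congr rfl fun j _ => ?_)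
  simp only [gradU]
  ring

lemma hasDerivAt_comp_dot_line {d : ℕ} {σ : ℝ → ℝ} (hσ : Differentiable ℝ σ)
    (w g v : Fin d → ℝ) (η : ℝ) :
    HasDerivAt (fun t : ℝ => σ (dot (w + t • g) v))
      (deriv σ (dot (w + η • g) v) * dot g v) η := by
  simp only [dot_add_smul_left]
  have hline : HasDerivAt (fun t : ℝ => dot w v + t * dot g v) (dot g v) η := by
    simpa using ((hasDerivAt_id η).mul_const (dot g v)).const_add (dot w v)
  exact (hσ _).hasDerivAt.comp η hline

lemma continuous_deriv_comp_dot_line {d : ℕ} {σ : ℝ → ℝ} (hσ : Continuous (deriv σ))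
    (w g v : Fin d → ℝ) :
    Continuous fun t : ℝ => deriv σ (dot (w + t • g) v) * dot g v := by
  simp only [dot_add_smul_left]
  fun_prop

/-- Fundamental theorem of calculus for the network output along the loss gradient. -/
lemma I0_eq {d m N : ℕ} {σ : ℝ → ℝ} (hσ : ContDiff ℝ 1 σ) (x : Fin N → Fin d → ℝ)
    (y : Fin N → ℝ) (a : Fin m → ℝ) (α : ℝ) (W : Fin m → Fin d → ℝ) (i : Fin N) :
    I0 σ x y a α W i
      = netOut σ (fun r => W r + α • gradLoss σ x y W a r) a (x i) - netOut σ W a (x i)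
        - α * ∑ r, dot (gradU σ a (x i) W r) (gradLoss σ x y W a r) := by
  simp only [I0, netOut, Finset.mul_sum, ← Finset.sum_sub_distrib]
  refine Finset.sum_congr rfl fun r _ => ?_
  have hcont := continuous_deriv_comp_dot_line (hσ.continuous_deriv le_rfl) (W r)
    (gradLoss σ x y W a r) (x i)
  have hftc := intervalIntegral.integral_eq_sub_of_hasDerivAt (a := 0) (b := α)
    (fun η _ => hasDerivAt_comp_dot_line (hσ.differentiable one_ne_zero) (W r)
      (gradLoss σ x y W a r) (x i) η) (hcont.intervalIntegrable 0 α)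
  simp only [dot_sub_left, dot_gradU]
  rw [intervalIntegral.integral_sub ((hcont.intervalIntegrable 0 α).const_mul _)
    intervalIntegrable_const, intervalIntegral.integral_const_mul, hftc,
    intervalIntegral.integral_const]
  simp only [zero_smul, add_zero, sub_zero, smul_eq_mul]
  ring

/-- under the IGD update, the residual vectors satisfy the exact
recursion `y - u(k+1) = (I + αH(k+1))⁻¹ [y - u(k) + I₀(k+1)]`. -/
theorem igd_residual_recursion
    (d m N : ℕ) (σ : ℝ → ℝ) (hσ : ContDiff ℝ (⊤ : ℕ∞) σ)
    (x : Fin N → Fin d → ℝ) (y : Fin N → ℝ)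
    (a : Fin m → ℝ) (ha : ∀ r, a r = 1 ∨ a r = -1)
    (α : ℝ) (hα : 0 < α)
    (W : ℕ → Fin m → Fin d → ℝ) (hW : IGD σ x y a α W)
    (hpos : ∀ n, 0 < lambdaMin (gram σ x (W n)))
    (k : ℕ) :
    (fun i => y i - netOut σ (W (k + 1)) a (x i)) =
      Matrix.mulVec
        (((1 : Matrix (Fin N) (Fin N) ℝ) + α • Matrix.of (gram σ x (W (k + 1))))⁻¹)
        (fun i => y i - netOut σ (W k) a (x i) + I0 σ x y a α (W (k + 1)) i) := by
  have hprev : W k = fun r => W (k + 1) r + α • gradLoss σ x y (W (k + 1)) a r := by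
    funext r
    rw [hW k r, sub_add_cancel]
  have hdet : IsUnit ((1 : Matrix (Fin N) (Fin N) ℝ)
      + α • Matrix.of (gram σ x (W (k + 1)))).det :=
    (Matrix.isUnit_iff_isUnit_det _).mp
      (Matrix.PosDef.one.add_posSemidef ((gram_posSemidef σ x (W (k + 1))).smul hα.le)).isUnit
  have hres : (fun i => y i - netOut σ (W k) a (x i) + I0 σ x y a α (W (k + 1)) i)
      = ((1 : Matrix (Fin N) (Fin N) ℝ) + α • Matrix.of (gram σ x (W (k + 1)))).mulVec
          (fun i => y i - netOut σ (W (k + 1)) a (x i)) := by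
    funext i
    rw [I0_eq (hσ.of_le (by exact_mod_cast le_top)), ← hprev,
      sum_dot_gradU_gradLoss σ x y a ha, Matrix.add_mulVec, Matrix.one_mulVec,
      Matrix.smul_mulVec]
    simp only [Pi.add_apply, Pi.smul_apply, smul_eq_mul, Matrix.mulVec, dotProduct,
      Matrix.of_apply]
    ring
  rw [hres, Matrix.mulVec_mulVec, Matrix.nonsing_inv_mul _ hdet, Matrix.one_mulVec]
end
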